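/- arXiv:2303.05267 — 5 statements merged into one kernel-verified Lean document; each statement's English description precedes it below -/
import Mathlib

section
/- All stabilizer generators of the Chamon model pairwise commute: for all s, s' ∈ A \ D, the symplectic form satisfies ω(S_s, S_{s'}) = 0 in ZMod 2. -/
namespace Chamon

/-- Ambient group `A = ZMod (2αx) × ZMod (2αy) × ZMod (2αz)`. -/
abbrev Amb (ax ay az : ℕ) : Type :=
  ZMod (2 * ax) × ZMod (2 * ay) × ZMod (2 * az)

/-- Reduction mod 2 of a coordinate. -/
def par {n : ℕ} (a : ZMod (2 * n)) : ZMod 2 :=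
  ZMod.castHom (dvd_mul_right 2 n) (ZMod 2) a

variable (ax ay az : ℕ)

def ex : Amb ax ay az := (1, 0, 0)
def ey : Amb ax ay az := (0, 1, 0)
def ez : Amb ax ay az := (0, 0, 1)

/-- The data-qubit set `D`. -/
def dataSet : Set (Amb ax ay az) :=
  {a | par a.1 + par a.2.1 + par a.2.2 = 0}

/-- A Pauli operator (modulo phase): a pair of functions `D → ZMod 2`. -/
abbrev Pauli : Type :=
  (↥(dataSet ax ay az) → ZMod 2) × (↥(dataSet ax ay az) → ZMod 2)

/-- The stabilizer generator `S_s`. -/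
def stab (s : Amb ax ay az) : Pauli ax ay az :=
  (fun d =>
      (if (d : Amb ax ay az) = s + ex ax ay az then 1 else 0) +
      (if (d : Amb ax ay az) = s - ex ax ay az then 1 else 0) +
      (if (d : Amb ax ay az) = s + ey ax ay az then 1 else 0) +
      (if (d : Amb ax ay az) = s - ey ax ay az then 1 else 0),
   fun d =>
      (if (d : Amb ax ay az) = s + ez ax ay az then 1 else 0) +
      (if (d : Amb ax ay az) = s - ez ax ay az then 1 else 0) +
      (if (d : Amb ax ay az) = s + ey ax ay az then 1 else 0) +
      (if (d : Amb ax ay az) = s - ey ax ay az then 1 else 0))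

/-- The symplectic form `ω(P,Q)`. -/
noncomputable def sympl (P Q : Pauli ax ay az) : ZMod 2 :=
  ∑ᶠ d : ↥(dataSet ax ay az), (P.1 d * Q.2 d + P.2 d * Q.1 d)

/-- `X|_E`: X-part is the indicator of `E`, Z-part is zero. -/
noncomputable def Xop (E : Set (Amb ax ay az)) : Pauli ax ay az :=
  (fun d => E.indicator (fun _ => (1 : ZMod 2)) (d : Amb ax ay az), fun _ => 0)

/-- `Z|_E`: Z-part is the indicator of `E`, X-part is zero. -/
noncomputable def Zop (E : Set (Amb ax ay az)) : Pauli ax ay az :=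
  (fun _ => 0, fun d => E.indicator (fun _ => (1 : ZMod 2)) (d : Amb ax ay az))

/-- The `ZMod 2`-linear span `𝒮` of the stabilizer generators. -/
def stabSpan : Submodule (ZMod 2) (Pauli ax ay az) :=
  Submodule.span (ZMod 2) (stab ax ay az '' (dataSet ax ay az)ᶜ)

/-- The four generating points `g₀, g₁, g₂, g₃`. -/
def gpt : Fin 4 → Amb ax ay az := ![(0,0,0), (1,1,0), (1,0,1), (0,1,1)]

/-- Half-plane support `D_x^g` (parallel to the `yOz` plane). -/
def Dxg (g : Amb ax ay az) : Set (Amb ax ay az) :=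
  {d | ∃ l m : ℤ, d = g + (2*l) • ez ax ay az + (2*m) • ey ax ay az}

/-- Half-plane support `D_z^g` (parallel to the `xOy` plane). -/
def Dzg (g : Amb ax ay az) : Set (Amb ax ay az) :=
  {d | ∃ l m : ℤ, d = g + (2*l) • ex ax ay az + (2*m) • ey ax ay az}

end Chamon


open Chamon

namespace Chamon

lemma par_add {n : ℕ} (a b : ZMod (2 * n)) : par (a + b) = par a + par b :=
  map_add _ a b

lemma par_sub {n : ℕ} (a b : ZMod (2 * n)) : par (a - b) = par a - par b :=
  map_sub _ a b

variable {ax ay az : ℕ}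

lemma add_sub_mem_dataSet {s t d : Amb ax ay az} (hs : s ∉ dataSet ax ay az)
    (ht : t ∉ dataSet ax ay az) (hd : d ∈ dataSet ax ay az) :
    s + t - d ∈ dataSet ax ay az := by
  simp only [dataSet, Set.mem_ofPred_eq, Prod.fst_add, Prod.snd_add, Prod.fst_sub, Prod.snd_sub,
    par_add, par_sub] at *
  generalize par s.1 = a₁ at *
  generalize par s.2.1 = a₂ at *
  generalize par s.2.2 = a₃ at *
  generalize par t.1 = b₁ at *
  generalize par t.2.1 = b₂ at *
  generalize par t.2.2 = b₃ at *
  have key : ∀ a b : ZMod 2, a ≠ 0 → b ≠ 0 → a + b = 0 := by decide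
  linear_combination key _ _ hs ht - hd

/-- Point reflection of the data qubits exchanging the stabilizer centers `s` and `t`. -/
def dataReflection {s t : Amb ax ay az} (hs : s ∉ dataSet ax ay az)
    (ht : t ∉ dataSet ax ay az) : Equiv.Perm (dataSet ax ay az) where
  toFun d := ⟨s + t - d, add_sub_mem_dataSet hs ht d.2⟩
  invFun d := ⟨s + t - d, add_sub_mem_dataSet hs ht d.2⟩
  left_inv _ := Subtype.ext (sub_sub_cancel _ _)
  right_inv _ := Subtype.ext (sub_sub_cancel _ _)

section Reflection

variable {G : Type*} [AddCommGroup G] (s t d e : G)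

lemma add_sub_eq_add_iff : s + t - d = s + e ↔ d = t - e := by
  constructor <;> intro h
  · rw [add_sub_assoc, add_right_inj] at h
    rw [← h, sub_sub_cancel]
  · rw [h]; abel

lemma add_sub_eq_sub_iff : s + t - d = s - e ↔ d = t + e := by
  rw [sub_eq_add_neg s e, add_sub_eq_add_iff, sub_neg_eq_add]

lemma add_sub_eq_add_iff' : s + t - d = t + e ↔ d = s - e := by
  rw [add_comm s t, add_sub_eq_add_iff]

lemma add_sub_eq_sub_iff' : s + t - d = t - e ↔ d = s + e := by
  rw [add_comm s t, add_sub_eq_sub_iff]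

end Reflection

variable {s t : Amb ax ay az} (hs : s ∉ dataSet ax ay az) (ht : t ∉ dataSet ax ay az)
  (d : dataSet ax ay az)

lemma stab_left_reflection :
    (stab ax ay az s).1 (dataReflection hs ht d) = (stab ax ay az t).1 d ∧
      (stab ax ay az s).2 (dataReflection hs ht d) = (stab ax ay az t).2 d := by
  simp only [stab, dataReflection, Equiv.coe_fn_mk, add_sub_eq_add_iff, add_sub_eq_sub_iff]
  constructor <;> ring

lemma stab_right_reflection :
    (stab ax ay az t).1 (dataReflection hs ht d) = (stab ax ay az s).1 d ∧
      (stab ax ay az t).2 (dataReflection hs ht d) = (stab ax ay az s).2 d := by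
  simp only [stab, dataReflection, Equiv.coe_fn_mk, add_sub_eq_add_iff', add_sub_eq_sub_iff']
  constructor <;> ring

end Chamon

/-- all stabilizer generators of the Chamon model pairwise commute. -/
theorem chamon_stabilizers_commute (ax ay az : ℕ)
    (hax : 2 ≤ ax) (hay : 2 ≤ ay) (haz : 2 ≤ az) :
    ∀ s ∉ dataSet ax ay az, ∀ s' ∉ dataSet ax ay az,
      sympl ax ay az (stab ax ay az s) (stab ax ay az s') = 0 := by
  intro s hs t ht
  have : NeZero (2 * ax) := ⟨by omega⟩
  have : NeZero (2 * ay) := ⟨by omega⟩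
  have : NeZero (2 * az) := ⟨by omega⟩
  have swap : ∑ᶠ d, (stab ax ay az s).1 d * (stab ax ay az t).2 d =
      ∑ᶠ d, (stab ax ay az s).2 d * (stab ax ay az t).1 d := by
    rw [← finsum_comp_equiv (dataReflection hs ht)]
    refine finsum_congr fun d => ?_
    rw [(stab_left_reflection hs ht d).1, (stab_right_reflection hs ht d).2, mul_comm]
  rw [sympl, finsum_add_distrib (Set.toFinite _) (Set.toFinite _), swap]
  exact CharTwo.add_self_eq_zero _
end

section
/- Half-plane logical operators can be translated by products of stabilizers: letting S' = {s ∈ A \ D : s = e_x^+ + 2λ e_y^+ + 2μ e_z^+, λ, μ ∈ ℤ} and g_0' = (2,0,0), one has Σ_{s ∈ S'} S_s = X|_{D_x^{g_0}} + X|_{D_x^{g_0'}} (componentwise addition of Pauli operators over ZMod 2); in particular X|_{D_x^{g_0}} and X|_{D_x^{g_0'}} lie in the same coset modulo 𝒮. -/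
open Chamon

namespace Chamon

/-- The set `S'` of stabilizer sites `e_x⁺ + 2λ e_y⁺ + 2μ e_z⁺`. -/
def planeSites (ax ay az : ℕ) : Set (Amb ax ay az) :=
  {s | ∃ l m : ℤ, s = ex ax ay az + (2*l) • ey ax ay az + (2*m) • ez ax ay az}

variable {ax ay az : ℕ}

theorem add_two_zsmul_mem_planeSites {s : Amb ax ay az} (hs : s ∈ planeSites ax ay az)
    (k n : ℤ) : s + (2*k) • ey ax ay az + (2*n) • ez ax ay az ∈ planeSites ax ay az := by
  obtain ⟨l, m, rfl⟩ := hs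
  exact ⟨l + k, m + n, by module⟩

theorem sub_ey_mem_planeSites_iff {d : Amb ax ay az} :
    d - ey ax ay az ∈ planeSites ax ay az ↔ d + ey ax ay az ∈ planeSites ax ay az := by
  constructor <;> intro h
  · convert add_two_zsmul_mem_planeSites h 1 0 using 1
    module
  · convert add_two_zsmul_mem_planeSites h (-1) 0 using 1
    module

theorem sub_ez_mem_planeSites_iff {d : Amb ax ay az} :
    d - ez ax ay az ∈ planeSites ax ay az ↔ d + ez ax ay az ∈ planeSites ax ay az := by
  constructor <;> intro h
  · convert add_two_zsmul_mem_planeSites h 0 1 using 1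
    module
  · convert add_two_zsmul_mem_planeSites h 0 (-1) using 1
    module

theorem add_ex_mem_planeSites_iff {d : Amb ax ay az} :
    d + ex ax ay az ∈ planeSites ax ay az ↔ d ∈ Dxg ax ay az (0, 0, 0) := by
  have h0 : ((0, 0, 0) : Amb ax ay az) = 0 := rfl
  rw [Dxg, h0]
  constructor
  · rintro ⟨l, m, h⟩
    exact ⟨m, l, by rw [eq_sub_of_add_eq h]; module⟩
  · rintro ⟨l, m, rfl⟩
    exact ⟨m, l, by module⟩

theorem sub_ex_mem_planeSites_iff {d : Amb ax ay az} :
    d - ex ax ay az ∈ planeSites ax ay az ↔ d ∈ Dxg ax ay az (2, 0, 0) := by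
  have h2 : ((2, 0, 0) : Amb ax ay az) = ex ax ay az + ex ax ay az := by
    simp [ex, one_add_one_eq_two]
  rw [Dxg, h2]
  constructor
  · rintro ⟨l, m, h⟩
    exact ⟨m, l, by rw [eq_add_of_sub_eq h]; module⟩
  · rintro ⟨l, m, rfl⟩
    exact ⟨m, l, by module⟩

theorem planeSites_subset_compl_dataSet :
    planeSites ax ay az ⊆ (dataSet ax ay az)ᶜ := by
  rintro _ ⟨l, m, rfl⟩
  have hc {n : ℕ} : ZMod.castHom (dvd_mul_right 2 n) (ZMod 2) 2 = 0 := map_ofNat _ 2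
  simp [dataSet, par, ex, ey, ez, -ZMod.castHom_apply, hc]

theorem sum_ite_eq_indicator {G : Type*} [AddGroup G] [DecidableEq G] (T : Finset G) (d v : G) :
    ∑ s ∈ T, (if d = s + v then (1 : ZMod 2) else 0) =
      (T : Set G).indicator (fun _ => 1) (d - v) := by
  classical
  simp only [← sub_eq_iff_eq_add, Finset.sum_ite_eq, Set.indicator_apply, Finset.mem_coe]

theorem finsum_stab_planeSites [NeZero ax] [NeZero ay] [NeZero az] :
    ∑ᶠ s ∈ planeSites ax ay az, stab ax ay az s =
      Xop ax ay az (Dxg ax ay az (0, 0, 0)) + Xop ax ay az (Dxg ax ay az (2, 0, 0)) := by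
  classical
  have hfin : (planeSites ax ay az).Finite := Set.toFinite _
  rw [finsum_mem_eq_finite_toFinset_sum _ hfin]
  ext d
  · simp only [stab, Prod.fst_sum, Finset.sum_apply, Finset.sum_add_distrib,
      sub_eq_add_neg, sum_ite_eq_indicator, Set.Finite.coe_toFinset, neg_neg, Xop,
      Prod.fst_add, Pi.add_apply, Set.indicator_apply]
    simp only [← sub_eq_add_neg, sub_ex_mem_planeSites_iff, add_ex_mem_planeSites_iff,
      sub_ey_mem_planeSites_iff, add_assoc, CharTwo.add_self_eq_zero, add_zero]
    exact add_comm _ _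
  · simp only [stab, Prod.snd_sum, Finset.sum_apply, Finset.sum_add_distrib,
      sub_eq_add_neg, sum_ite_eq_indicator, Set.Finite.coe_toFinset, neg_neg, Xop,
      Prod.snd_add, Pi.add_apply, Set.indicator_apply]
    simp only [← sub_eq_add_neg, sub_ez_mem_planeSites_iff,
      sub_ey_mem_planeSites_iff, add_assoc, CharTwo.add_self_eq_zero]

theorem finsum_stab_mem_stabSpan {T : Set (Amb ax ay az)} (hT : T ⊆ (dataSet ax ay az)ᶜ) :
    ∑ᶠ s ∈ T, stab ax ay az s ∈ stabSpan ax ay az :=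
  finsum_mem_induction (· ∈ stabSpan ax ay az) (zero_mem _) (fun _ _ => add_mem)
    fun _ hs => Submodule.subset_span (Set.mem_image_of_mem _ (hT hs))

end Chamon

/-- translating half-plane logical operators by a product of
stabilizers: `Σ_{s ∈ S'} S_s = X|_{D_x^{g₀}} + X|_{D_x^{g₀'}}` where
`S' = {e_x⁺ + 2λ e_y⁺ + 2μ e_z⁺}`, `g₀ = (0,0,0)`, `g₀' = (2,0,0)`; in particular
the two half-plane operators lie in the same coset modulo `𝒮`. -/
theorem chamon_halfplane_translation (ax ay az : ℕ)
    (hax : 2 ≤ ax) (hay : 2 ≤ ay) (haz : 2 ≤ az) :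
    (∑ᶠ s ∈ {s : Amb ax ay az |
        ∃ l m : ℤ, s = ex ax ay az + (2*l) • ey ax ay az + (2*m) • ez ax ay az},
        stab ax ay az s) =
      Xop ax ay az (Dxg ax ay az ((0,0,0) : Amb ax ay az)) +
      Xop ax ay az (Dxg ax ay az ((2,0,0) : Amb ax ay az)) ∧
    Xop ax ay az (Dxg ax ay az ((0,0,0) : Amb ax ay az)) -
      Xop ax ay az (Dxg ax ay az ((2,0,0) : Amb ax ay az)) ∈ stabSpan ax ay az := by
  have : NeZero ax := ⟨by omega⟩
  have : NeZero ay := ⟨by omega⟩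
  have : NeZero az := ⟨by omega⟩
  refine ⟨finsum_stab_planeSites, ?_⟩
  have hsub (P Q : Pauli ax ay az) : P - Q = P + Q := by
    ext d <;> exact CharTwo.sub_eq_add _ _
  rw [hsub, ← finsum_stab_planeSites]
  exact finsum_stab_mem_stabSpan planeSites_subset_compl_dataSet
end

section
/- Suppose α_x = α_y = α_z = α ≥ 2. Then the code distance of the Chamon model with linear dimensions α, α, α equals 2α. -/
namespace Chamon

variable (ax ay az : ℕ)

/-- A logical operator: a Pauli operator commuting with every stabilizer
generator and not lying in the stabilizer span `𝒮`. -/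
def IsLogical (P : Pauli ax ay az) : Prop :=
  (∀ s ∉ dataSet ax ay az, sympl ax ay az (stab ax ay az s) P = 0) ∧
  P ∉ stabSpan ax ay az

/-- The weight of a Pauli operator: the number of data qubits on which it acts
nontrivially. -/
noncomputable def wt (P : Pauli ax ay az) : ℕ :=
  {d : ↥(dataSet ax ay az) | ¬ (P.1 d = 0 ∧ P.2 d = 0)}.ncard

/-- The code distance: the minimum weight of a logical operator. -/
noncomputable def codeDistance : ℕ :=
  sInf {n | ∃ P : Pauli ax ay az, IsLogical ax ay az P ∧ wt ax ay az P = n}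

end Chamon

namespace Chamon

/-- The sum of `f` over the four nearest neighbours of `(j, k)` on the discrete torus. -/
def nbrSum {n : ℕ} (f : ZMod n → ZMod n → ZMod 2) (j k : ZMod n) : ZMod 2 :=
  f (j + 1) k + f (j - 1) k + f j (k + 1) + f j (k - 1)

theorem le_sum_of_gaps {n : ℕ} [NeZero n] (w : ZMod n → ℕ)
    (h₁ : ∀ i, w i = 0 → w (i + 1) ≠ 0)
    (h₂ : ∀ i, w i = 0 → w (i + 1) = 1 → 2 ≤ w (i + 2)) : n ≤ ∑ i, w i := by
  classical
  let φ : ZMod n → ZMod n := fun i => if 2 ≤ w (i + 1) then i + 1 else i + 2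
  have hcard : (Finset.univ.filter fun i => w i = 0).card ≤
      (Finset.univ.filter fun i => 2 ≤ w i).card := by
    refine Finset.card_le_card_of_injOn φ ?_ ?_
    · intro i hi
      simp only [Finset.coe_filter, Finset.mem_univ, true_and, Set.mem_ofPred_eq] at hi ⊢
      have := h₁ i hi
      have := h₂ i hi
      simp only [φ]
      split_ifs with h
      · exact h
      · exact h₂ i hi (by omega)
    · intro i hi j hj hij
      simp only [Finset.coe_filter, Finset.mem_univ, true_and, Set.mem_ofPred_eq] at hi hj
      simp only [φ] at hij
      split_ifs at hij with h h' h'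
      · exact add_right_cancel hij
      · exact absurd hi (by rw [show i = j + 1 by linear_combination hij]; exact h₁ j hj)
      · exact absurd hj (by rw [show j = i + 1 by linear_combination -hij]; exact h₁ i hi)
      · exact add_right_cancel hij
  have hsum : ∑ i, (1 + if 2 ≤ w i then 1 else 0) ≤ ∑ i, (w i + if w i = 0 then 1 else 0) := by
    refine Finset.sum_le_sum fun i _ => ?_
    split_ifs <;> omega
  simp only [Finset.sum_add_distrib, Finset.sum_const, Finset.card_univ, ZMod.card, smul_eq_mul,
    mul_one, Finset.sum_boole, Nat.cast_id] at hsum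
  omega

theorem sum_nbrSum {n : ℕ} [NeZero n] (f : ZMod n → ZMod n → ZMod 2) :
    ∑ j, ∑ k, nbrSum f j k = 0 := by
  have h₁ : ∑ j, ∑ k, f (j + 1) k = ∑ j, ∑ k, f j k :=
    Equiv.sum_comp (Equiv.addRight (1 : ZMod n)) fun j => ∑ k, f j k
  have h₂ : ∑ j, ∑ k, f (j - 1) k = ∑ j, ∑ k, f j k :=
    Equiv.sum_comp (Equiv.subRight (1 : ZMod n)) fun j => ∑ k, f j k
  have h₃ : ∀ j, ∑ k, f j (k + 1) = ∑ k, f j k := fun j =>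
    Equiv.sum_comp (Equiv.addRight (1 : ZMod n)) (f j)
  have h₄ : ∀ j, ∑ k, f j (k - 1) = ∑ k, f j k := fun j =>
    Equiv.sum_comp (Equiv.subRight (1 : ZMod n)) (f j)
  simp only [nbrSum, Finset.sum_add_distrib, h₁, h₂, h₃, h₄]
  grind

theorem sum_diag_nbrSum {n : ℕ} [NeZero n] (f : ZMod n → ZMod n → ZMod 2) (c : ZMod n) :
    ∑ j, nbrSum f j (c - j) = 0 := by
  have h₁ : ∑ j, f (j + 1) (c - j) = ∑ j, f j (c - j + 1) := by
    rw [← Equiv.sum_comp (Equiv.addRight (1 : ZMod n)) fun j => f j (c - j + 1)]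
    exact Finset.sum_congr rfl fun j _ => by
      simp only [Equiv.coe_addRight]
      congr 1
      ring
  have h₂ : ∑ j, f (j - 1) (c - j) = ∑ j, f j (c - j - 1) := by
    rw [← Equiv.sum_comp (Equiv.subRight (1 : ZMod n)) fun j => f j (c - j - 1)]
    exact Finset.sum_congr rfl fun j _ => by
      simp only [Equiv.subRight_apply]
      congr 1
      ring
  simp only [nbrSum, Finset.sum_add_distrib, h₁, h₂]
  grind

/-- Every solution of the discrete wave equation on a strip of even circumference is periodic
in time. -/
theorem wave_add_two_mul {n : ℕ} (g : ℕ → ZMod n → ZMod n → ZMod 2)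
    (hg : ∀ m j k, g (m + 2) j k = g (m + 1) j (k + 1) + g (m + 1) j (k - 1) + g m j k) (l : ℕ) :
    ∀ m j k, g (m + 2 * l) j k + g m j k = g (m + l) j (k + l) + g (m + l) j (k - l) := by
  induction l using Nat.strong_induction_on with
  | _ l ih =>
    match l with
    | 0 => intro m j k; simp
    | 1 => intro m j k; have := hg m j k; simp; grind
    | l + 2 =>
      intro m j k
      have e₁ := hg (m + 2 * l + 2) j k
      have e₂ := hg m j k
      have i₀ := ih l (by omega) (m + 2) j k
      have i₁ := ih (l + 1) (by omega) (m + 1) j (k + 1)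
      have i₂ := ih (l + 1) (by omega) (m + 1) j (k - 1)
      push_cast at *
      have r₁ : k + 1 + ((l : ZMod n) + 1) = k + (l + 2) := by ring
      have r₂ : k + 1 - ((l : ZMod n) + 1) = k - l := by ring
      have r₃ : k - 1 + ((l : ZMod n) + 1) = k + l := by ring
      have r₄ : k - 1 - ((l : ZMod n) + 1) = k - (l + 2) := by ring
      rw [r₁, r₂] at i₁
      rw [r₃, r₄] at i₂
      rw [show m + 1 + 2 * (l + 1) = m + 2 * l + 2 + 1 by ring,
        show m + 1 + (l + 1) = m + (l + 2) by ring] at i₁ i₂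
      rw [show m + 2 + 2 * l = m + 2 * l + 2 by ring,
        show m + 2 + l = m + (l + 2) by ring] at i₀
      rw [show m + 2 * (l + 2) = m + 2 * l + 2 + 2 by ring]
      grind

/-- The solution of the discrete wave equation with initial data `a`, `b`. -/
def wave {n : ℕ} (a b : ZMod n → ZMod n → ZMod 2) : ℕ → ZMod n → ZMod n → ZMod 2
  | 0 => a
  | 1 => b
  | m + 2 => fun j k => wave a b (m + 1) j (k + 1) + wave a b (m + 1) j (k - 1) + wave a b m j k

theorem exists_wave {n : ℕ} [NeZero n] (hn : Even n) (r : ZMod n → ZMod n → ZMod n → ZMod 2)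
    (hr : ∀ i j k, nbrSum (fun i' k' => nbrSum (fun j' => r i' j') j k') i k = 0) :
    ∃ g : ZMod n → ZMod n → ZMod n → ZMod 2,
      (∀ i j k, nbrSum (fun i' => g i' j) i k = 0) ∧
      ∀ i j k, nbrSum (g i) j k = nbrSum (r i) j k := by
  obtain ⟨l, hnl⟩ := hn
  let g := wave (r 0) (r 1)
  have hg : ∀ m j k, g (m + 2) j k = g (m + 1) j (k + 1) + g (m + 1) j (k - 1) + g m j k :=
    fun m j k => by simp only [g, wave]
  have hper : Function.Periodic g n := by
    intro m
    funext j k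
    have h := wave_add_two_mul g hg l m j k
    have hl : k - (l : ZMod n) = k + l := by
      have : ((l + l : ℕ) : ZMod n) = 0 := hnl ▸ ZMod.natCast_self n
      push_cast at this
      linear_combination -this
    rw [hl, two_mul, ← hnl] at h
    grind
  have hval : ∀ m : ℕ, g (m : ZMod n).val = g m := fun m => by
    rw [ZMod.val_natCast, hper.map_mod_nat]
  have hrec : ∀ (m : ℕ) j k, nbrSum (r ((m + 2 : ℕ) : ZMod n)) j k =
      nbrSum (r ((m + 1 : ℕ) : ZMod n)) j (k + 1) + nbrSum (r ((m + 1 : ℕ) : ZMod n)) j (k - 1) +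
      nbrSum (r (m : ZMod n)) j k := by
    intro m j k
    have h := hr ((m + 1 : ℕ) : ZMod n) j k
    change nbrSum (r (((m + 1 : ℕ) : ZMod n) + 1)) j k + nbrSum (r (((m + 1 : ℕ) : ZMod n) - 1)) j k +
      nbrSum (r ((m + 1 : ℕ) : ZMod n)) j (k + 1) +
      nbrSum (r ((m + 1 : ℕ) : ZMod n)) j (k - 1) = 0 at h
    rw [show (((m + 1 : ℕ) : ZMod n) + 1) = ((m + 2 : ℕ) : ZMod n) by push_cast; ring,
      show (((m + 1 : ℕ) : ZMod n) - 1) = (m : ZMod n) by push_cast; ring] at h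
    grind
  have hgr : ∀ m : ℕ, (∀ j k, nbrSum (g m) j k = nbrSum (r (m : ZMod n)) j k) ∧
      ∀ j k, nbrSum (g (m + 1)) j k = nbrSum (r ((m + 1 : ℕ) : ZMod n)) j k := by
    intro m
    induction m with
    | zero => simp [g, wave]
    | succ m ih =>
      refine ⟨ih.2, fun j k => ?_⟩
      rw [hrec, ← ih.2, ← ih.2, ← ih.1]
      simp only [nbrSum, hg, sub_add_cancel, add_sub_cancel_right]
      ring
  refine ⟨fun i => g i.val, fun i j k => ?_, fun i j k => ?_⟩
  · obtain ⟨m, hm⟩ : ∃ m : ℕ, (m : ZMod n) = i - 1 := ⟨(i - 1).val, ZMod.natCast_zmod_val _⟩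
    obtain rfl : i = ((m + 1 : ℕ) : ZMod n) := by push_cast; rw [hm]; ring
    rw [nbrSum]
    rw [show (((m + 1 : ℕ) : ZMod n) + 1) = ((m + 2 : ℕ) : ZMod n) by push_cast; ring, ← hm]
    simp only [hval, hg]
    grind
  · simpa [ZMod.natCast_zmod_val] using (hgr i.val).1 j k

theorem exists_nbrSum_of_nbrSum {n : ℕ} [NeZero n] (hn : Even n)
    {p q t t' : ZMod n → ZMod n → ZMod n → ZMod 2}
    (h : ∀ i j k, nbrSum (fun i' => q i' j) i k = nbrSum (p i) j k)
    (hp : ∀ i j k, p i j k = nbrSum (fun i' => t i' j) i k)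
    (hq : ∀ i j k, q i j k = nbrSum (t' i) j k) :
    ∃ s : ZMod n → ZMod n → ZMod n → ZMod 2,
      (∀ i j k, p i j k = nbrSum (fun i' => s i' j) i k) ∧
      ∀ i j k, q i j k = nbrSum (s i) j k := by
  obtain ⟨g, hg₁, hg₂⟩ := exists_wave hn (fun i j k => t i j k + t' i j k) (by
    intro i j k
    have := h i j k
    simp only [nbrSum, hp, hq] at this ⊢
    grind)
  refine ⟨fun i j k => t i j k + g i j k, fun i j k => ?_, fun i j k => ?_⟩
  · rw [hp]
    have := hg₁ i j k
    simp only [nbrSum] at this ⊢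
    linear_combination -this
  · rw [hq]
    have := hg₂ i j k
    simp only [nbrSum] at this ⊢
    grind

theorem natCast_card_support {ι : Type*} [Fintype ι] (f : ι → ZMod 2) :
    ((Finset.univ.filter fun y => f y ≠ 0).card : ZMod 2) = ∑ y, f y := by
  rw [Finset.card_filter, Nat.cast_sum]
  refine Finset.sum_congr rfl fun y _ => ?_
  generalize f y = b
  revert b
  decide

theorem exists_nbrSum_or_le_card {n : ℕ} [NeZero n] (hn : (2 : ZMod n) ≠ 0)
    (p q : ZMod n → ZMod n → ZMod n → ZMod 2)
    (h : ∀ i j k, nbrSum (fun i' => p i' j) i k = nbrSum (q i) j k) :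
    (∃ t : ZMod n → ZMod n → ZMod n → ZMod 2, ∀ i j k, p i j k = nbrSum (t i) j k) ∨
      n ≤ (Finset.univ.filter fun y : ZMod n × ZMod n × ZMod n => p y.1 y.2.1 y.2.2 ≠ 0).card := by
  classical
  let T : ZMod n → Prop := fun i => ∃ t, ∀ j k, p i j k = nbrSum t j k
  by_cases H : ∃ i, T i ∧ T (i + 1)
  · left
    obtain ⟨i, hi⟩ := H
    have step : ∀ i, T i → T (i + 1) → T (i + 1 + 1) := by
      rintro i ⟨a, ha⟩ ⟨b, hb⟩
      refine ⟨fun j k => q (i + 1) j k + a j k + b j (k + 1) + b j (k - 1), fun j k => ?_⟩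
      have e := h (i + 1) j k
      simp only [nbrSum, add_sub_cancel_right, ha, hb] at e ⊢
      grind
    have all : ∀ m : ℕ, T (i + m) ∧ T (i + m + 1) := by
      intro m
      induction m with
      | zero => simpa using hi
      | succ m ih =>
        rw [Nat.cast_succ, ← add_assoc]
        exact ⟨ih.2, step _ ih.1 ih.2⟩
    have all' : ∀ i', T i' := fun i' => by
      have := (all (i' - i).val).1
      rwa [ZMod.natCast_zmod_val, add_sub_cancel] at this
    choose t ht using all'
    exact ⟨t, ht⟩
  · right
    push Not at H
    let w : ZMod n → ℕ := fun i =>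
      (Finset.univ.filter fun y : ZMod n × ZMod n => p i y.1 y.2 ≠ 0).card
    have hw : (Finset.univ.filter fun y : ZMod n × ZMod n × ZMod n =>
        p y.1 y.2.1 y.2.2 ≠ 0).card = ∑ i, w i := by
      simp only [w, Finset.card_filter, Fintype.sum_prod_type]
    have hw₀ : ∀ i, w i = 0 → ∀ j k, p i j k = 0 := by
      intro i hi j k
      by_contra hne
      exact (Finset.card_pos.2 ⟨(j, k), by simpa using hne⟩).ne' hi
    have hT : ∀ i, w i = 0 → T i := fun i hi =>
      ⟨fun _ _ => 0, fun j k => by simp [hw₀ i hi, nbrSum]⟩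
    rw [hw]
    refine le_sum_of_gaps w (fun i hi hi' => H i (hT i hi) (hT _ hi')) fun i hi hi' => ?_
    have e : ∀ j k, p (i + 2) j k + p (i + 1) j (k + 1) + p (i + 1) j (k - 1) =
        nbrSum (q (i + 1)) j k := by
      intro j k
      rw [← h, nbrSum, add_sub_cancel_right, hw₀ i hi, show i + 1 + 1 = i + 2 by ring]
      ring
    have heven : ((w (i + 2) : ℕ) : ZMod 2) = 0 := by
      rw [natCast_card_support, Fintype.sum_prod_type, ← sum_nbrSum (q (i + 1))]
      have h₃ : ∀ j, ∑ k, p (i + 1) j (k + 1) = ∑ k, p (i + 1) j k := fun j =>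
        Equiv.sum_comp (Equiv.addRight (1 : ZMod n)) (p (i + 1) j)
      have h₄ : ∀ j, ∑ k, p (i + 1) j (k - 1) = ∑ k, p (i + 1) j k := fun j =>
        Equiv.sum_comp (Equiv.subRight (1 : ZMod n)) (p (i + 1) j)
      simp only [← e, Finset.sum_add_distrib, h₃, h₄, add_assoc, CharTwo.add_self_eq_zero, add_zero]
    have hne : w (i + 2) ≠ 0 := by
      intro h₂
      obtain ⟨⟨j₀, k₀⟩, hy⟩ := Finset.card_eq_one.1 hi'
      have hp : ∀ j k, p (i + 1) j k = if j = j₀ ∧ k = k₀ then 1 else 0 := by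
        intro j k
        have := Finset.ext_iff.1 hy (j, k)
        simp only [Finset.mem_filter, Finset.mem_univ, true_and, Finset.mem_singleton,
          Prod.mk.injEq] at this
        simp only [← this]
        generalize p (i + 1) j k = b
        revert b
        decide
      have hs := sum_diag_nbrSum (q (i + 1)) (j₀ + k₀ + 1)
      simp only [← e, hw₀ _ h₂, zero_add, hp, Finset.sum_add_distrib, ite_and,
        Finset.sum_ite_eq', Finset.mem_univ, if_true] at hs
      rw [if_neg (fun h' => hn (by linear_combination h')), if_pos (by ring)] at hs
      exact absurd hs (by decide)
    rw [ZMod.natCast_eq_zero_iff] at heven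
    omega

theorem par_add_one {n : ℕ} (a : ZMod (2 * n)) : par (a + 1) = par a + 1 := by
  simp [par]

theorem par_sub_one {n : ℕ} (a : ZMod (2 * n)) : par (a - 1) = par a + 1 := by
  rw [par, map_sub, map_one, CharTwo.sub_eq_add, par]

theorem zmod_two_add_one_eq_zero_iff (b : ZMod 2) : b + 1 = 0 ↔ b ≠ 0 := by
  revert b
  decide

section

variable {a₁ a₂ a₃ : ℕ} {x : ZMod (2 * a₁)} {y : ZMod (2 * a₂)} {z : ZMod (2 * a₃)}

theorem mem_dataSet_iff : (x, y, z) ∈ dataSet a₁ a₂ a₃ ↔ par x + par y + par z = 0 := Iff.rfl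

theorem add_ex_mem_iff : (x + 1, y, z) ∈ dataSet a₁ a₂ a₃ ↔ (x, y, z) ∉ dataSet a₁ a₂ a₃ := by
  simp only [mem_dataSet_iff, par_add_one]
  rw [← ne_eq, ← zmod_two_add_one_eq_zero_iff]
  ring_nf

theorem sub_ex_mem_iff : (x - 1, y, z) ∈ dataSet a₁ a₂ a₃ ↔ (x, y, z) ∉ dataSet a₁ a₂ a₃ := by
  simp only [mem_dataSet_iff, par_sub_one]
  rw [← ne_eq, ← zmod_two_add_one_eq_zero_iff]
  ring_nf

theorem add_ey_mem_iff : (x, y + 1, z) ∈ dataSet a₁ a₂ a₃ ↔ (x, y, z) ∉ dataSet a₁ a₂ a₃ := by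
  simp only [mem_dataSet_iff, par_add_one]
  rw [← ne_eq, ← zmod_two_add_one_eq_zero_iff]
  ring_nf

theorem sub_ey_mem_iff : (x, y - 1, z) ∈ dataSet a₁ a₂ a₃ ↔ (x, y, z) ∉ dataSet a₁ a₂ a₃ := by
  simp only [mem_dataSet_iff, par_sub_one]
  rw [← ne_eq, ← zmod_two_add_one_eq_zero_iff]
  ring_nf

theorem add_ez_mem_iff : (x, y, z + 1) ∈ dataSet a₁ a₂ a₃ ↔ (x, y, z) ∉ dataSet a₁ a₂ a₃ := by
  simp only [mem_dataSet_iff, par_add_one]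
  rw [← ne_eq, ← zmod_two_add_one_eq_zero_iff]
  ring_nf

theorem sub_ez_mem_iff : (x, y, z - 1) ∈ dataSet a₁ a₂ a₃ ↔ (x, y, z) ∉ dataSet a₁ a₂ a₃ := by
  simp only [mem_dataSet_iff, par_sub_one]
  rw [← ne_eq, ← zmod_two_add_one_eq_zero_iff]
  ring_nf

end

open Classical in
/-- Extension of a function on the data qubits by zero. -/
noncomputable def extend {a₁ a₂ a₃ : ℕ} (f : dataSet a₁ a₂ a₃ → ZMod 2) (a : Amb a₁ a₂ a₃) :
    ZMod 2 :=
  if h : a ∈ dataSet a₁ a₂ a₃ then f ⟨a, h⟩ else 0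

theorem extend_of_mem {a₁ a₂ a₃ : ℕ} (f : dataSet a₁ a₂ a₃ → ZMod 2) {a : Amb a₁ a₂ a₃}
    (h : a ∈ dataSet a₁ a₂ a₃) : extend f a = f ⟨a, h⟩ := dif_pos h

theorem extend_of_notMem {a₁ a₂ a₃ : ℕ} (f : dataSet a₁ a₂ a₃ → ZMod 2) {a : Amb a₁ a₂ a₃}
    (h : a ∉ dataSet a₁ a₂ a₃) : extend f a = 0 := dif_neg h

theorem extend_coe {a₁ a₂ a₃ : ℕ} (f : dataSet a₁ a₂ a₃ → ZMod 2) (d : dataSet a₁ a₂ a₃) :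
    extend f d = f d := extend_of_mem f d.2

theorem sum_ite_mul {a₁ a₂ a₃ : ℕ} [Fintype (dataSet a₁ a₂ a₃)] (f : dataSet a₁ a₂ a₃ → ZMod 2)
    (a : Amb a₁ a₂ a₃) :
    ∑ d : dataSet a₁ a₂ a₃, (if (d : Amb a₁ a₂ a₃) = a then 1 else 0) * f d = extend f a := by
  by_cases h : a ∈ dataSet a₁ a₂ a₃
  · rw [extend_of_mem f h, Finset.sum_eq_single ⟨a, h⟩]
    · simp
    · intro d _ hd
      rw [if_neg fun h' => hd (Subtype.ext h'), zero_mul]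
    · simp
  · rw [extend_of_notMem f h]
    refine Finset.sum_eq_zero fun d _ => ?_
    rw [if_neg fun h' : (d : Amb a₁ a₂ a₃) = a => h (h' ▸ d.2), zero_mul]

theorem sympl_stab {a : ℕ} [NeZero (2 * a)] (x y z : ZMod (2 * a)) (P : Pauli a a a) :
    sympl a a a (stab a a a (x, y, z)) P =
      nbrSum (fun x' y' => extend P.2 (x', y', z)) x y +
        nbrSum (fun z' y' => extend P.1 (x, y', z')) z y := by
  classical
  rw [sympl, finsum_eq_sum_of_fintype]
  simp only [stab, add_mul, Finset.sum_add_distrib, sum_ite_mul, nbrSum, ex, ey, ez,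
    Prod.mk_add_mk, Prod.mk_sub_mk, add_zero, sub_zero]

theorem commutes_iff {a : ℕ} [NeZero (2 * a)] (P : Pauli a a a) :
    (∀ s ∉ dataSet a a a, sympl a a a (stab a a a s) P = 0) ↔
      ∀ x z y, nbrSum (fun x' y' => extend P.2 (x', y', z)) x y =
        nbrSum (fun z' y' => extend P.1 (x, y', z')) z y := by
  constructor
  · intro h x z y
    by_cases hs : (x, y, z) ∈ dataSet a a a
    · simp only [nbrSum]
      rw [extend_of_notMem, extend_of_notMem, extend_of_notMem, extend_of_notMem,
        extend_of_notMem, extend_of_notMem, extend_of_notMem, extend_of_notMem] <;>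
      simp only [add_ex_mem_iff, sub_ex_mem_iff, add_ey_mem_iff, sub_ey_mem_iff, add_ez_mem_iff,
        sub_ez_mem_iff, not_not, hs]
    · exact CharTwo.add_eq_zero.1 ((sympl_stab x y z P).symm.trans (h _ hs))
  · rintro h ⟨x, y, z⟩ -
    rw [sympl_stab, h, CharTwo.add_self_eq_zero]

theorem sum_compl_mul_ite {a₁ a₂ a₃ : ℕ} [Fintype (Amb a₁ a₂ a₃)] [DecidableEq (Amb a₁ a₂ a₃)]
    [DecidablePred (· ∉ dataSet a₁ a₂ a₃)]
    (f : Amb a₁ a₂ a₃ → ZMod 2) {a b : Amb a₁ a₂ a₃} (e : Amb a₁ a₂ a₃) (hab : b = a + e)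
    (ha : a ∉ dataSet a₁ a₂ a₃) :
    ∑ s with s ∉ dataSet a₁ a₂ a₃, f s * (if b = s + e then 1 else 0) = f a := by
  subst hab
  simp only [add_left_inj, mul_ite, mul_one, mul_zero]
  rw [Finset.sum_ite_eq, if_pos (by simpa using ha)]

theorem mem_stabSpan_of_nbrSum {a : ℕ} [NeZero (2 * a)] {P : Pauli a a a}
    (s : ZMod (2 * a) → ZMod (2 * a) → ZMod (2 * a) → ZMod 2)
    (h₁ : ∀ x z y, extend P.1 (x, y, z) = nbrSum (fun x' => s x' z) x y)
    (h₂ : ∀ x z y, extend P.2 (x, y, z) = nbrSum (s x) z y) : P ∈ stabSpan a a a := by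
  classical
  have hP : P = ∑ c with c ∉ dataSet a a a, s c.1 c.2.2 c.2.1 • stab a a a c := by
    refine Prod.ext ?_ ?_
    · funext ⟨⟨x, y, z⟩, hd⟩
      rw [Prod.fst_sum, Finset.sum_apply, ← extend_of_mem P.1 hd, h₁]
      simp only [Prod.smul_fst, Pi.smul_apply, stab, smul_eq_mul, mul_add, sub_eq_add_neg,
        Finset.sum_add_distrib]
      have hd' := not_not.2 hd
      rw [sum_compl_mul_ite _ _ (a := (x - 1, y, z)) (by simp [ex]) (by rwa [sub_ex_mem_iff]),
        sum_compl_mul_ite _ _ (a := (x + 1, y, z)) (by simp [ex]) (by rwa [add_ex_mem_iff]),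
        sum_compl_mul_ite _ _ (a := (x, y - 1, z)) (by simp [ey]) (by rwa [sub_ey_mem_iff]),
        sum_compl_mul_ite _ _ (a := (x, y + 1, z)) (by simp [ey]) (by rwa [add_ey_mem_iff]), nbrSum]
      ring
    · funext ⟨⟨x, y, z⟩, hd⟩
      rw [Prod.snd_sum, Finset.sum_apply, ← extend_of_mem P.2 hd, h₂]
      simp only [Prod.smul_snd, Pi.smul_apply, stab, smul_eq_mul, mul_add, sub_eq_add_neg,
        Finset.sum_add_distrib]
      have hd' := not_not.2 hd
      rw [sum_compl_mul_ite _ _ (a := (x, y, z - 1)) (by simp [ez]) (by rwa [sub_ez_mem_iff]),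
        sum_compl_mul_ite _ _ (a := (x, y, z + 1)) (by simp [ez]) (by rwa [add_ez_mem_iff]),
        sum_compl_mul_ite _ _ (a := (x, y - 1, z)) (by simp [ey]) (by rwa [sub_ey_mem_iff]),
        sum_compl_mul_ite _ _ (a := (x, y + 1, z)) (by simp [ey]) (by rwa [add_ey_mem_iff]), nbrSum]
      ring
  rw [hP]
  refine Submodule.sum_mem _ fun c hc => Submodule.smul_mem _ _ (Submodule.subset_span ?_)
  exact Set.mem_image_of_mem _ (by simpa using hc)

theorem card_le_wt {a : ℕ} [NeZero (2 * a)] (P : Pauli a a a) (f : dataSet a a a → ZMod 2)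
    (hf : ∀ d, f d ≠ 0 → ¬ (P.1 d = 0 ∧ P.2 d = 0))
    (e : Amb a a a ≃ Amb a a a) :
    (Finset.univ.filter fun c => extend f (e c) ≠ 0).card ≤ wt a a a P := by
  classical
  rw [← Set.ncard_coe_finset, wt]
  refine (Set.ncard_le_ncard ?_ (Set.toFinite _)).trans
    (Set.ncard_image_le (f := fun d : dataSet a a a => e.symm d) (Set.toFinite _))
  intro c hc
  have hc' : extend f (e c) ≠ 0 := by simpa using hc
  by_cases hd : e c ∈ dataSet a a a
  · rw [extend_of_mem f hd] at hc'
    exact ⟨⟨e c, hd⟩, hf _ hc', e.symm_apply_apply c⟩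
  · exact absurd (extend_of_notMem f hd) hc'

theorem two_mul_le_wt {a : ℕ} (ha : 2 ≤ a) {P : Pauli a a a} (hP : IsLogical a a a P) :
    2 * a ≤ wt a a a P := by
  have : NeZero (2 * a) := ⟨by omega⟩
  have h2 : (2 : ZMod (2 * a)) ≠ 0 := by
    intro h
    have := (ZMod.natCast_eq_zero_iff 2 (2 * a)).1 (by exact_mod_cast h)
    have := Nat.le_of_dvd (by norm_num) this
    omega
  have hc := (commutes_iff P).1 hP.1
  rcases exists_nbrSum_or_le_card h2 (fun x z y => extend P.2 (x, y, z))
    (fun x z y => extend P.1 (x, y, z)) hc with ⟨t', ht'⟩ | h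
  · rcases exists_nbrSum_or_le_card h2 (fun z x y => extend P.1 (x, y, z))
      (fun z x y => extend P.2 (x, y, z)) (fun z x y => (hc x z y).symm) with ⟨t, ht⟩ | h
    · obtain ⟨s, hs₁, hs₂⟩ := exists_nbrSum_of_nbrSum (even_two_mul a)
        (p := fun x z y => extend P.1 (x, y, z)) (q := fun x z y => extend P.2 (x, y, z))
        (t := fun x z y => t z x y) hc (fun x z y => ht z x y) ht'
      exact absurd (mem_stabSpan_of_nbrSum s hs₁ hs₂) hP.2
    · exact h.trans (card_le_wt P P.1 (fun d hd h' => hd h'.1)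
        ⟨fun c => (c.2.1, c.2.2, c.1), fun c => (c.2.2, c.1, c.2.1), fun _ => rfl, fun _ => rfl⟩)
  · exact h.trans (card_le_wt P P.2 (fun d hd h' => hd h'.2)
      ⟨fun c => (c.1, c.2.2, c.2.1), fun c => (c.1, c.2.2, c.2.1), fun _ => rfl, fun _ => rfl⟩)

/-- The `Z`-type string operator supported on the diagonal `{(k, k, 0)}`. -/
noncomputable def diagZ (a : ℕ) : Pauli a a a :=
  Zop a a a {c | c.1 = c.2.1 ∧ c.2.2 = 0}

theorem diag_mem_dataSet {a : ℕ} (k : ZMod (2 * a)) : (k, k, 0) ∈ dataSet a a a := by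
  rw [mem_dataSet_iff, CharTwo.add_self_eq_zero, par, map_zero, add_zero]

theorem extend_diagZ_snd {a : ℕ} (x y z : ZMod (2 * a)) :
    extend (diagZ a).2 (x, y, z) = if x = y ∧ z = 0 then 1 else 0 := by
  classical
  by_cases h : (x, y, z) ∈ dataSet a a a
  · rw [extend_of_mem _ h]
    simp [diagZ, Zop, Set.indicator_apply]
  · rw [extend_of_notMem _ h, if_neg]
    rintro ⟨rfl, rfl⟩
    exact h (diag_mem_dataSet x)

theorem wt_diagZ (a : ℕ) : wt a a a (diagZ a) = 2 * a := by
  have : {d : dataSet a a a | ¬ ((diagZ a).1 d = 0 ∧ (diagZ a).2 d = 0)} =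
      Set.range fun k : ZMod (2 * a) => (⟨(k, k, 0), diag_mem_dataSet k⟩ : dataSet a a a) := by
    ext ⟨⟨x, y, z⟩, hd⟩
    have : (diagZ a).2 ⟨(x, y, z), hd⟩ = if x = y ∧ z = 0 then 1 else 0 := by
      rw [← extend_diagZ_snd, extend_of_mem]
    simp only [Set.mem_ofPred_eq, this, Set.mem_range, Subtype.mk.injEq, Prod.mk.injEq]
    simp only [diagZ, Zop, true_and, ite_eq_right_iff, one_ne_zero, imp_false, not_not]
    constructor
    · rintro ⟨rfl, rfl⟩
      exact ⟨x, rfl, rfl, rfl⟩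
    · rintro ⟨k, rfl, rfl, rfl⟩
      exact ⟨rfl, rfl⟩
  rw [wt, this, ← Set.image_univ, Set.ncard_image_of_injective, Set.ncard_univ, Nat.card_zmod]
  intro k l h
  simpa using h

/-- The pairing of a Pauli operator with the `X`-type plane operator at `x = 0`, `y` even. -/
noncomputable def planePairing (a : ℕ) [Fintype (dataSet a a a)] : Pauli a a a →ₗ[ZMod 2] ZMod 2 where
  toFun P := ∑ d : dataSet a a a, P.2 d * (if d.1.1 = 0 ∧ par d.1.2.1 = 0 then 1 else 0)
  map_add' P Q := by simp only [Prod.snd_add, Pi.add_apply, add_mul, Finset.sum_add_distrib]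
  map_smul' c P := by simp [Finset.mul_sum]

theorem planePairing_stab {a : ℕ} [Fintype (dataSet a a a)] {s : Amb a a a} (hs : s ∉ dataSet a a a) :
    planePairing a (stab a a a s) = 0 := by
  obtain ⟨x, y, z⟩ := s
  simp only [planePairing, LinearMap.coe_mk, AddHom.coe_mk, stab, add_mul, Finset.sum_add_distrib]
  rw [sum_ite_mul (fun d => if d.1.1 = 0 ∧ par d.1.2.1 = 0 then 1 else 0),
    sum_ite_mul (fun d => if d.1.1 = 0 ∧ par d.1.2.1 = 0 then 1 else 0),
    sum_ite_mul (fun d => if d.1.1 = 0 ∧ par d.1.2.1 = 0 then 1 else 0),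
    sum_ite_mul (fun d => if d.1.1 = 0 ∧ par d.1.2.1 = 0 then 1 else 0)]
  simp only [ey, ez, Prod.mk_add_mk, Prod.mk_sub_mk, add_zero, sub_zero]
  rw [extend_of_mem _ (add_ez_mem_iff.2 hs), extend_of_mem _ (sub_ez_mem_iff.2 hs),
    extend_of_mem _ (add_ey_mem_iff.2 hs), extend_of_mem _ (sub_ey_mem_iff.2 hs)]
  simp only [par_add_one, par_sub_one, add_assoc, CharTwo.add_self_eq_zero]

theorem planePairing_diagZ (a : ℕ) [Fintype (dataSet a a a)] : planePairing a (diagZ a) = 1 := by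
  have h : ∀ d : dataSet a a a, (diagZ a).2 d = if d.1.1 = d.1.2.1 ∧ d.1.2.2 = 0 then 1 else 0 :=
    fun d => by rw [← extend_diagZ_snd, extend_coe]
  simp only [planePairing, LinearMap.coe_mk, AddHom.coe_mk, h]
  rw [Finset.sum_eq_single ⟨(0, 0, 0), diag_mem_dataSet 0⟩]
  · simp [par]
  · rintro ⟨⟨x, y, z⟩, hd⟩ - hne
    simp only [mul_ite, mul_one, mul_zero, ← ite_and]
    rw [if_neg]
    rintro ⟨⟨rfl, -⟩, rfl, rfl⟩
    exact hne rfl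
  · simp

theorem isLogical_diagZ (a : ℕ) [NeZero (2 * a)] : IsLogical a a a (diagZ a) := by
  refine ⟨(commutes_iff _).2 fun x z y => ?_, fun h => ?_⟩
  · have h₁ : ∀ c, extend (diagZ a).1 c = 0 := fun c => by
      simp [extend, diagZ, Zop]
    simp only [nbrSum, h₁, extend_diagZ_snd]
    have e₁ : x + 1 = y ↔ x = y - 1 := eq_sub_iff_add_eq.symm
    have e₂ : x - 1 = y ↔ x = y + 1 := sub_eq_iff_eq_add
    simp only [e₁, e₂]
    grind
  · have := Fintype.ofFinite (dataSet a a a)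
    have hle : stabSpan a a a ≤ LinearMap.ker (planePairing a) := by
      rw [stabSpan, Submodule.span_le]
      rintro _ ⟨s, hs, rfl⟩
      exact planePairing_stab hs
    have := LinearMap.mem_ker.1 (hle h)
    rw [planePairing_diagZ] at this
    exact one_ne_zero this

end Chamon

open Chamon

/-- for `αx = αy = αz = α`, the code distance of the Chamon model
equals `2α`. -/
theorem chamon_code_distance_cubic (α : ℕ) (hα : 2 ≤ α) :
    codeDistance α α α = 2 * α := by
  have : NeZero (2 * α) := ⟨by omega⟩
  refine IsLeast.csInf_eq (a := 2 * α) ⟨⟨diagZ α, isLogical_diagZ α, wt_diagZ α⟩, ?_⟩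
  rintro _ ⟨P, hP, rfl⟩
  exact two_mul_le_wt hα hP
end

section
/- For every Pauli operator E and every class index i ∈ {0,1,2,3}, the number of sites s in the stabilizer class C_i whose measurement changes under E is even; that is, the cardinality of {s ∈ C_i : ω(S_s, E) = 1} is even. -/
namespace Chamon

/-- The base points `s₀ = (0,1,0)`, `s₁ = (1,0,0)`, `s₂ = (0,0,1)`, `s₃ = (1,1,1)`
of the four stabilizer classes. -/
def spt (ax ay az : ℕ) : Fin 4 → Amb ax ay az := ![(0,1,0), (1,0,0), (0,0,1), (1,1,1)]

/-- The stabilizer class `C_i = {s_i + 2λ e_x⁺ + 2μ e_y⁺ + 2ν e_z⁺ : λ, μ, ν ∈ ℤ}`. -/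
def stabClass (ax ay az : ℕ) (i : Fin 4) : Set (Amb ax ay az) :=
  {s | ∃ l m n : ℤ, s = spt ax ay az i + (2*l) • ex ax ay az
        + (2*m) • ey ax ay az + (2*n) • ez ax ay az}

end Chamon

namespace Chamon

/-- If `C` is invariant under translation by `2e`, every `d` is of the form `s + e` or `s - e`
with `s ∈ C` an even number of times. -/
theorem sum_translates_eq_zero {G : Type*} [AddCommGroup G] [DecidableEq G] (C : Finset G) (e d : G)
    (hC : ∀ s, s + (e + e) ∈ C ↔ s ∈ C) :
    ∑ s ∈ C, ((if d = s + e then 1 else 0) + (if d = s - e then 1 else 0) : ZMod 2) = 0 := by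
  have h₁ : ∀ s, d = s + e ↔ d - e = s := fun s => by rw [sub_eq_iff_eq_add]
  have h₂ : ∀ s, d = s - e ↔ d + e = s := fun s => by rw [eq_sub_iff_add_eq]
  have h₃ : d + e ∈ C ↔ d - e ∈ C := by
    rw [← hC (d - e), show d - e + (e + e) = d + e by abel]
  simp only [Finset.sum_add_distrib, h₁, h₂, Finset.sum_ite_eq, h₃]
  exact CharTwo.add_self_eq_zero _

theorem sum_stab_fst_eq_zero {ax ay az : ℕ} (C : Finset (Amb ax ay az))
    (hx : ∀ s, s + (ex ax ay az + ex ax ay az) ∈ C ↔ s ∈ C)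
    (hy : ∀ s, s + (ey ax ay az + ey ax ay az) ∈ C ↔ s ∈ C) (d : dataSet ax ay az) :
    ∑ s ∈ C, (stab ax ay az s).1 d = 0 := by
  have h := congrArg₂ (· + ·) (sum_translates_eq_zero C _ (d : Amb ax ay az) hx)
    (sum_translates_eq_zero C _ (d : Amb ax ay az) hy)
  simpa only [stab, ← Finset.sum_add_distrib, add_assoc, add_zero] using h

theorem sum_stab_snd_eq_zero {ax ay az : ℕ} (C : Finset (Amb ax ay az))
    (hz : ∀ s, s + (ez ax ay az + ez ax ay az) ∈ C ↔ s ∈ C)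
    (hy : ∀ s, s + (ey ax ay az + ey ax ay az) ∈ C ↔ s ∈ C) (d : dataSet ax ay az) :
    ∑ s ∈ C, (stab ax ay az s).2 d = 0 := by
  have h := congrArg₂ (· + ·) (sum_translates_eq_zero C _ (d : Amb ax ay az) hz)
    (sum_translates_eq_zero C _ (d : Amb ax ay az) hy)
  simpa only [stab, ← Finset.sum_add_distrib, add_assoc, add_zero] using h

theorem add_two_ex_mem_stabClass {ax ay az : ℕ} (i : Fin 4) (s : Amb ax ay az) :
    s + (ex ax ay az + ex ax ay az) ∈ stabClass ax ay az i ↔ s ∈ stabClass ax ay az i := by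
  constructor
  · rintro ⟨l, m, n, h⟩
    exact ⟨l - 1, m, n, by rw [eq_sub_of_add_eq h]; module⟩
  · rintro ⟨l, m, n, rfl⟩
    exact ⟨l + 1, m, n, by module⟩

theorem add_two_ey_mem_stabClass {ax ay az : ℕ} (i : Fin 4) (s : Amb ax ay az) :
    s + (ey ax ay az + ey ax ay az) ∈ stabClass ax ay az i ↔ s ∈ stabClass ax ay az i := by
  constructor
  · rintro ⟨l, m, n, h⟩
    exact ⟨l, m - 1, n, by rw [eq_sub_of_add_eq h]; module⟩
  · rintro ⟨l, m, n, rfl⟩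
    exact ⟨l, m + 1, n, by module⟩

theorem add_two_ez_mem_stabClass {ax ay az : ℕ} (i : Fin 4) (s : Amb ax ay az) :
    s + (ez ax ay az + ez ax ay az) ∈ stabClass ax ay az i ↔ s ∈ stabClass ax ay az i := by
  constructor
  · rintro ⟨l, m, n, h⟩
    exact ⟨l, m, n - 1, by rw [eq_sub_of_add_eq h]; module⟩
  · rintro ⟨l, m, n, rfl⟩
    exact ⟨l, m, n + 1, by module⟩

/-- The product of the stabilizer generators in one class is trivial, so it commutes with
every Pauli operator. -/
theorem sum_sympl_stab_eq_zero {ax ay az : ℕ} [NeZero ax] [NeZero ay] [NeZero az]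
    (C : Finset (Amb ax ay az)) (i : Fin 4) (hC : ∀ s, s ∈ C ↔ s ∈ stabClass ax ay az i)
    (E : Pauli ax ay az) :
    ∑ s ∈ C, sympl ax ay az (stab ax ay az s) E = 0 := by
  have hx := add_two_ex_mem_stabClass (ax := ax) (ay := ay) (az := az) i
  have hy := add_two_ey_mem_stabClass (ax := ax) (ay := ay) (az := az) i
  have hz := add_two_ez_mem_stabClass (ax := ax) (ay := ay) (az := az) i
  simp only [← hC] at hx hy hz
  have : Fintype (dataSet ax ay az) := Fintype.ofFinite _
  simp only [sympl, finsum_eq_sum_of_fintype]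
  rw [Finset.sum_comm]
  simp only [Finset.sum_add_distrib, ← Finset.sum_mul, sum_stab_fst_eq_zero C hx hy,
    sum_stab_snd_eq_zero C hz hy, zero_mul, Finset.sum_const_zero, add_zero]

/-- The parity of the support of a `ZMod 2`-valued function is its sum. -/
theorem card_filter_eq_one_eq_sum {α : Type*} (C : Finset α) (f : α → ZMod 2) :
    ((C.filter fun s => f s = 1).card : ZMod 2) = ∑ s ∈ C, f s := by
  rw [Finset.card_filter, Nat.cast_sum]
  refine Finset.sum_congr rfl fun s _ => ?_
  generalize f s = a
  revert a
  decide

end Chamon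

open Chamon

/-- for every Pauli operator `E` and every stabilizer class `C_i`,
the number of sites in `C_i` whose syndrome under `E` is nontrivial is even. -/
theorem chamon_even_syndrome_per_class (ax ay az : ℕ)
    (hax : 2 ≤ ax) (hay : 2 ≤ ay) (haz : 2 ≤ az) :
    ∀ E : Pauli ax ay az, ∀ i : Fin 4,
      Even ({s ∈ stabClass ax ay az i |
        sympl ax ay az (stab ax ay az s) E = 1}).ncard := by
  intro E i
  have : NeZero ax := ⟨by omega⟩
  have : NeZero ay := ⟨by omega⟩
  have : NeZero az := ⟨by omega⟩
  classical
  let C : Finset (Amb ax ay az) := (Set.toFinite (stabClass ax ay az i)).toFinset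
  have hC : ∀ s, s ∈ C ↔ s ∈ stabClass ax ay az i := fun s => Set.Finite.mem_toFinset _
  have hset : {s ∈ stabClass ax ay az i | sympl ax ay az (stab ax ay az s) E = 1} =
      ↑(C.filter fun s => sympl ax ay az (stab ax ay az s) E = 1) := by
    ext s
    simp [hC]
  rw [hset, Set.ncard_coe_finset, ← ZMod.natCast_eq_zero_iff_even, card_filter_eq_one_eq_sum,
    sum_sympl_stab_eq_zero C i hC]
end

section
/- If gcd(α_x, α_y) = 1, then the element (1,1) of ZMod (2α_x) × ZMod (2α_y) has additive order 2·α_x·α_y, and the cyclic subgroup it generates equals the even-parity sublattice {(a,b) ∈ ZMod (2α_x) × ZMod (2α_y) : π_x(a) = π_y(b)}, where π_x, π_y are the reductions mod 2; in other words, the diagonally arranged sites fill an entire plane of the Chamon model under the periodic boundary conditions. -/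
open Chamon

theorem par_intCast {n : ℕ} (m : ℤ) : par (m : ZMod (2 * n)) = (m : ZMod 2) :=
  map_intCast (ZMod.castHom (dvd_mul_right 2 n) (ZMod 2)) m

/-- Two integers of the same parity are simultaneously congruent to a single integer
modulo `2 * a` and `2 * b` when `a` and `b` are coprime. -/
theorem exists_int_dvd_sub_of_two_dvd {a b : ℕ} (hco : Nat.Coprime a b) {m n : ℤ}
    (h : (2 : ℤ) ∣ n - m) :
    ∃ t : ℤ, (2 * a : ℤ) ∣ m - t ∧ (2 * b : ℤ) ∣ n - t := by
  obtain ⟨k, hk⟩ := h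
  obtain ⟨u, v, huv⟩ := Nat.isCoprime_iff_coprime.mpr hco
  refine ⟨m + 2 * a * u * k, ⟨-(u * k), by ring⟩, ⟨v * k, ?_⟩⟩
  linear_combination hk - 2 * k * huv

/-- if `gcd(αx, αy) = 1`, then `(1,1) ∈ ZMod (2αx) × ZMod (2αy)` has
additive order `2·αx·αy`, and the cyclic subgroup it generates is exactly the
even-parity sublattice `{(a,b) : a ≡ b (mod 2)}`: the diagonally arranged sites
fill an entire plane of the Chamon model. -/
theorem chamon_diagonal_fills_plane (ax ay : ℕ)
    (hax : 2 ≤ ax) (hay : 2 ≤ ay) (hco : Nat.Coprime ax ay) :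
    addOrderOf ((1, 1) : ZMod (2 * ax) × ZMod (2 * ay)) = 2 * ax * ay ∧
    (AddSubgroup.zmultiples ((1, 1) : ZMod (2 * ax) × ZMod (2 * ay)) : Set _) =
      {p : ZMod (2 * ax) × ZMod (2 * ay) | par p.1 = par p.2} := by
  constructor
  · rw [Prod.addOrderOf_mk, ZMod.addOrderOf_one, ZMod.addOrderOf_one, Nat.lcm_mul_left,
      hco.lcm_eq_mul, mul_assoc]
  · ext ⟨x, y⟩
    obtain ⟨m, rfl⟩ := ZMod.intCast_surjective x
    obtain ⟨n, rfl⟩ := ZMod.intCast_surjective y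
    simp only [SetLike.mem_coe, AddSubgroup.mem_zmultiples_iff, Set.mem_ofPred_eq, par_intCast,
      Prod.smul_mk, zsmul_one, Prod.mk.injEq]
    constructor
    · rintro ⟨t, hx, hy⟩
      rw [← par_intCast (n := ax), ← par_intCast (n := ay), ← hx, ← hy, par_intCast, par_intCast]
    · intro h
      obtain ⟨t, hm, hn⟩ :=
        exists_int_dvd_sub_of_two_dvd hco ((ZMod.intCast_eq_intCast_iff_dvd_sub m n 2).mp h)
      exact ⟨t, (ZMod.intCast_eq_intCast_iff_dvd_sub t m _).mpr (mod_cast hm),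
        (ZMod.intCast_eq_intCast_iff_dvd_sub t n _).mpr (mod_cast hn)⟩
end
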